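/- Suppose l(p) = 0. Then γ''(p) = (l'(p)/y(p))·R_{−η(p)}·U(p). In particular, γ''(p) ≠ 0 if and only if l'(p) ≠ 0. -/

import Mathlib

open Real

/-- Rotation of the plane by angle `θ`. -/
noncomputable def rot (θ : ℝ) (v : ℝ × ℝ) : ℝ × ℝ :=
  (Real.cos θ * v.1 - Real.sin θ * v.2, Real.sin θ * v.1 + Real.cos θ * v.2)

/-- Determinant of the 2×2 matrix with columns `v`, `w`. -/
def det2 (v w : ℝ × ℝ) : ℝ := v.1 * w.2 - v.2 * w.1

theorem hasDerivAt_of_eq_integral {f g : ℝ → ℝ} (hg : Continuous g)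
    (hf : ∀ t, f t = ∫ u in (0:ℝ)..t, g u) (t : ℝ) : HasDerivAt f (g t) t := by
  rw [funext hf]
  exact intervalIntegral.integral_hasDerivAt_right (hg.intervalIntegrable _ _)
    (hg.stronglyMeasurableAtFilter _ _) hg.continuousAt

theorem rot_eq_zero_iff (θ : ℝ) (v : ℝ × ℝ) : rot θ v = 0 ↔ v = 0 := by
  constructor
  · intro h
    have h₁ : cos θ * v.1 - sin θ * v.2 = 0 := congrArg Prod.fst h
    have h₂ : sin θ * v.1 + cos θ * v.2 = 0 := congrArg Prod.snd h
    ext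
    · rw [Prod.fst_zero]
      linear_combination cos θ * h₁ + sin θ * h₂ - v.1 * (sin_sq_add_cos_sq θ)
    · rw [Prod.snd_zero]
      linear_combination cos θ * h₂ - sin θ * h₁ - v.2 * (sin_sq_add_cos_sq θ)
  · rintro rfl
    simp [rot]

/-- If `f` vanishes at `p`, the product rule for `f • w` at `p` has a single term. -/
theorem HasDerivAt.smul_of_eq_zero {E : Type*} [NormedAddCommGroup E] [NormedSpace ℝ E]
    {f : ℝ → ℝ} {w : ℝ → E} {f' p : ℝ} (hf : HasDerivAt f f' p) (h0 : f p = 0)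
    (hw : DifferentiableAt ℝ w p) : HasDerivAt (fun t => f t • w t) (f' • w p) p := by
  have h := hf.smul hw.hasDerivAt
  rw [h0, zero_smul, zero_add] at h
  exact h

/-- At a singular point `p`, `γ''(p) = (l'(p)/y(p)) R_{−η(p)} U(p)`; in particular
`γ''(p) ≠ 0` iff `l'(p) ≠ 0`. -/
theorem second_deriv_at_singular_point
    (l h : ℝ → ℝ) (hl : ContDiff ℝ (⊤ : ℕ∞) l) (hh : ContDiff ℝ (⊤ : ℕ∞) h)
    (η F G : ℝ → ℝ)
    (hη : ∀ u, η u = ∫ v in (0:ℝ)..u, 2 * h v)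
    (hF : ∀ t, F t = ∫ u in (0:ℝ)..t, l u * sin (η u))
    (hG : ∀ t, G t = ∫ u in (0:ℝ)..t, l u * cos (η u))
    (c₁ c₂ : ℝ)
    (hpos : ∀ t, 0 < (F t - c₁) ^ 2 + (G t - c₂) ^ 2)
    (y x : ℝ → ℝ)
    (hy : ∀ t, y t = Real.sqrt ((F t - c₁) ^ 2 + (G t - c₂) ^ 2))
    (hx : ∀ t, x t = ∫ u in (0:ℝ)..t,
      (deriv F u * (G u - c₂) - deriv G u * (F u - c₁)) / y u)
    (γ : ℝ → ℝ × ℝ) (hγ : ∀ t, γ t = (x t, y t))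
    (U : ℝ → ℝ × ℝ) (hU : ∀ t, U t = (-(F t - c₁), G t - c₂))
    (p : ℝ) (hlp : l p = 0) :
    iteratedDeriv 2 γ p = (deriv l p / y p) • rot (-(η p)) (U p) ∧
    (iteratedDeriv 2 γ p ≠ 0 ↔ deriv l p ≠ 0) := by
  have hηd := hasDerivAt_of_eq_integral (continuous_const.mul hh.continuous) hη
  have hηc : Continuous η := continuous_iff_continuousAt.2 fun t => (hηd t).continuousAt
  have hFd := hasDerivAt_of_eq_integral (hl.continuous.mul (continuous_sin.comp hηc)) hF
  have hGd := hasDerivAt_of_eq_integral (hl.continuous.mul (continuous_cos.comp hηc)) hG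
  have hFc : Continuous F := continuous_iff_continuousAt.2 fun t => (hFd t).continuousAt
  have hGc : Continuous G := continuous_iff_continuousAt.2 fun t => (hGd t).continuousAt
  have hypos : ∀ t, 0 < y t := fun t => by rw [hy]; exact sqrt_pos.2 (hpos t)
  have hyd : ∀ t, HasDerivAt y
      (l t * (sin (η t) * (F t - c₁) + cos (η t) * (G t - c₂)) / y t) t := by
    intro t
    have hd := ((((hFd t).sub_const c₁).pow 2).add (((hGd t).sub_const c₂).pow 2)).sqrt
      (hpos t).ne'
    rw [funext hy]
    refine hd.congr_deriv ?_
    have := (sqrt_pos.2 (hpos t)).ne'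
    simp only [Pi.add_apply, Pi.pow_apply]
    field_simp
    simp
    ring
  have hyc : Continuous y := continuous_iff_continuousAt.2 fun t => (hyd t).continuousAt
  have hx' : ∀ t, x t = ∫ u in (0:ℝ)..t,
      l u * (sin (η u) * (G u - c₂) - cos (η u) * (F u - c₁)) / y u := by
    intro t
    rw [hx]
    congr 1 with u
    rw [(hFd u).deriv, (hGd u).deriv]
    simp only [Pi.mul_apply, Function.comp_apply]
    ring
  have hxd := hasDerivAt_of_eq_integral (by
    refine Continuous.div ?_ hyc fun t => (hypos t).ne'
    have := hl.continuous
    fun_prop) hx'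
  have hγd : deriv γ = fun t => l t • ((y t)⁻¹ • rot (-(η t)) (U t)) := by
    funext t
    rw [show γ = fun t => (x t, y t) from funext hγ, ((hxd t).prodMk (hyd t)).deriv]
    ext <;> simp [rot, hU] <;> ring
  have hwd : DifferentiableAt ℝ (fun t => (y t)⁻¹ • rot (-(η t)) (U t)) p := by
    have hη' := (hηd p).differentiableAt
    have hF' := (hFd p).differentiableAt
    have hG' := (hGd p).differentiableAt
    have hy' := (hyd p).differentiableAt
    have hy0 := (hypos p).ne'
    simp only [rot, hU]
    fun_prop (disch := assumption)
  have hld : HasDerivAt l (deriv l p) p := (hl.differentiable (by simp) p).hasDerivAt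
  have hmain : iteratedDeriv 2 γ p = (deriv l p / y p) • rot (-(η p)) (U p) := by
    rw [iteratedDeriv_succ, iteratedDeriv_one, hγd,
      (hld.smul_of_eq_zero hlp hwd).deriv, smul_smul, div_eq_mul_inv]
  refine ⟨hmain, not_congr ?_⟩
  have hU0 : U p ≠ 0 := by
    intro h0
    rw [hU, Prod.mk_eq_zero, neg_eq_zero] at h0
    have := hpos p
    simp [h0.1, h0.2] at this
  rw [hmain, smul_eq_zero, rot_eq_zero_iff, or_iff_left hU0, div_eq_zero_iff,
    or_iff_left (hypos p).ne']
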